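/- Let n ≥ 1, let f_1, …, f_n : ℝ^d → ℝ be differentiable convex functions whose gradients are L-Lipschitz (L > 0), let f = (1/n)∑_{i=1}^n f_i, and let x* be a global minimizer of f. Let x, w ∈ ℝ^d, let θ ∈ (0, 1), p ∈ (0, 1], and let η > 0 satisfy η ≤ 1/( L·(1 + 1/(1 − θ)) ). Define u = θx + (1 − θ)w, and for each i ∈ {1,…,n} define g_i = ∇f_i(u) − ∇f_i(w) + ∇f(w), x⁺_i = x − (η/θ)·g_i, and b_i = θ·x⁺_i + (1 − θ)·w. Then (η/(pθ²))·( (1/n)∑_{i=1}^n [ p·f(b_i) + (1 − p)·f(w) ] − f(x*) ) ≤ ((1 − pθ)η/(pθ²))·( f(w) − f(x*) ) + (1/2)·( ‖x − x*‖² − (1/n)∑_{i=1}^n ‖x⁺_i − x*‖² ). -/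

import Mathlib

open scoped RealInnerProductSpace

section Smoothness

variable {E : Type*} [NormedAddCommGroup E] [InnerProductSpace ℝ E] [CompleteSpace E]

theorem HasGradientAt.hasDerivAt_lineMap {f : E → ℝ} {f' x y : E} {t : ℝ}
    (h : HasGradientAt f f' (x + t • (y - x))) :
    HasDerivAt (fun s : ℝ => f (x + s • (y - x))) ⟪f', y - x⟫ t := by
  have hline : HasDerivAt (fun s : ℝ => x + s • (y - x)) (y - x) t := by
    simpa using ((hasDerivAt_id t).smul_const (y - x)).const_add x
  have := h.hasFDerivAt.comp_hasDerivAt t hline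
  rwa [InnerProductSpace.toDual_apply_apply] at this

theorem ConvexOn.add_inner_gradient_le {f : E → ℝ} (hf : ConvexOn ℝ Set.univ f) {f' x : E}
    (h : HasGradientAt f f' x) (y : E) : f x + ⟪f', y - x⟫ ≤ f y := by
  have hline : ConvexOn ℝ Set.univ (fun s : ℝ => f (x + s • (y - x))) := by
    have := hf.comp_affineMap (AffineMap.lineMap x y : ℝ →ᵃ[ℝ] E)
    simpa [Function.comp_def, AffineMap.lineMap_apply, add_comm] using this
  have h0 : HasDerivAt (fun s : ℝ => f (x + s • (y - x))) ⟪f', y - x⟫ 0 :=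
    HasGradientAt.hasDerivAt_lineMap (by simpa using h)
  have := hline.le_slope_of_hasDerivAt (Set.mem_univ 0) (Set.mem_univ 1) one_pos h0
  simp [slope_def_field] at this
  linarith

/-- The descent lemma for a function with `L`-Lipschitz gradient. -/
theorem le_add_inner_gradient_add_sq {f : E → ℝ} {L : ℝ} (hf : Differentiable ℝ f)
    (hlip : ∀ x y, ‖gradient f x - gradient f y‖ ≤ L * ‖x - y‖) (x y : E) :
    f y ≤ f x + ⟪gradient f x, y - x⟫ + L / 2 * ‖y - x‖ ^ 2 := by
  set φ : ℝ → ℝ := fun t =>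
    f (x + t • (y - x)) - (t * ⟪gradient f x, y - x⟫ + t ^ 2 * (L / 2 * ‖y - x‖ ^ 2)) with hφ
  have hderiv (t : ℝ) : HasDerivAt φ (⟪gradient f (x + t • (y - x)), y - x⟫ -
      (⟪gradient f x, y - x⟫ + 2 * t * (L / 2 * ‖y - x‖ ^ 2))) t := by
    refine ((hf _).hasGradientAt.hasDerivAt_lineMap).sub (HasDerivAt.add ?_ ?_)
    · simpa using (hasDerivAt_id t).mul_const ⟪gradient f x, y - x⟫
    · simpa using (hasDerivAt_pow 2 t).mul_const (L / 2 * ‖y - x‖ ^ 2)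
  have hanti : AntitoneOn φ (Set.Icc 0 1) := by
    refine antitoneOn_of_hasDerivWithinAt_nonpos (convex_Icc 0 1)
      (fun t _ => (hderiv t).continuousAt.continuousWithinAt)
      (fun t _ => (hderiv t).hasDerivWithinAt) fun t ht => ?_
    rw [interior_Icc] at ht
    have hinner : ⟪gradient f (x + t • (y - x)) - gradient f x, y - x⟫ ≤
        L * (t * ‖y - x‖) * ‖y - x‖ := by
      refine (real_inner_le_norm _ _).trans ?_
      gcongr
      simpa [norm_smul, abs_of_pos ht.1] using hlip (x + t • (y - x)) x
    rw [inner_sub_left] at hinner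
    linarith
  have := hanti (Set.left_mem_Icc.2 zero_le_one) (Set.right_mem_Icc.2 zero_le_one) zero_le_one
  simp only [hφ, one_smul, zero_smul, add_sub_cancel, add_zero] at this
  linarith

theorem ConvexOn.norm_gradient_sub_sq_le {f : E → ℝ} {L : ℝ} (hL : 0 < L)
    (hconv : ConvexOn ℝ Set.univ f) (hf : Differentiable ℝ f)
    (hlip : ∀ x y, ‖gradient f x - gradient f y‖ ≤ L * ‖x - y‖) (u w : E) :
    ‖gradient f u - gradient f w‖ ^ 2 ≤
      2 * L * (f w - f u - ⟪gradient f u, w - u⟫) := by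
  set a := gradient f u - gradient f w with ha
  have hlow := hconv.add_inner_gradient_le (hf u).hasGradientAt (w + L⁻¹ • a)
  have hupp := le_add_inner_gradient_add_sq hf hlip w (w + L⁻¹ • a)
  have hsq : ⟪gradient f u, a⟫ - ⟪gradient f w, a⟫ = ‖a‖ ^ 2 := by
    rw [← inner_sub_left, ← ha, real_inner_self_eq_norm_sq]
  rw [show w + L⁻¹ • a - u = (w - u) + L⁻¹ • a by abel, inner_add_right,
    real_inner_smul_right] at hlow
  rw [add_sub_cancel_left, real_inner_smul_right, norm_smul, Real.norm_of_nonneg (by positivity),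
    mul_pow] at hupp
  have hkey : L⁻¹ * ‖a‖ ^ 2 ≤ f w - f u - ⟪gradient f u, w - u⟫
      + L / 2 * ((L⁻¹) ^ 2 * ‖a‖ ^ 2) := by
    have := congrArg (L⁻¹ * ·) hsq
    simp only [mul_sub] at this
    linarith
  have hhalf : L / 2 * ((L⁻¹) ^ 2 * ‖a‖ ^ 2) = ‖a‖ ^ 2 / (2 * L) := by
    field_simp
  have hinv : L⁻¹ * ‖a‖ ^ 2 = 2 * (‖a‖ ^ 2 / (2 * L)) := by
    field_simp
  have : ‖a‖ ^ 2 / (2 * L) ≤ f w - f u - ⟪gradient f u, w - u⟫ := by linarith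
  rwa [div_le_iff₀' (by positivity)] at this

theorem hasGradientAt_average {n : ℕ} {f : Fin n → E → ℝ}
    (hf : ∀ i, Differentiable ℝ (f i)) (x : E) :
    HasGradientAt (fun x => (1 / (n : ℝ)) * ∑ i, f i x)
      ((1 / (n : ℝ)) • ∑ i, gradient (f i) x) x := by
  rw [hasGradientAt_iff_hasFDerivAt]
  simpa using (HasFDerivAt.fun_sum (u := Finset.univ)
    fun i _ => (hf i x).hasGradientAt.hasFDerivAt).const_mul (1 / (n : ℝ))

end Smoothness

theorem average_const {n : ℕ} (hn : 1 ≤ n) (c : ℝ) :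
    (1 / (n : ℝ)) * ∑ _i : Fin n, c = c := by
  have : (n : ℝ) ≠ 0 := by positivity
  simp [this]

theorem average_mono {n : ℕ} {a b : Fin n → ℝ} (h : ∀ i, a i ≤ b i) :
    (1 / (n : ℝ)) * ∑ i, a i ≤ (1 / (n : ℝ)) * ∑ i, b i :=
  mul_le_mul_of_nonneg_left (Finset.sum_le_sum fun i _ => h i) (by positivity)

/-- The scalar inequality behind the step-size condition. -/
theorem stepSize_inequality {L θ η N D Q : ℝ} (hL : 0 < L) (hθ : θ ∈ Set.Ioo (0 : ℝ) 1)
    (hη : 0 < η) (hηle : η ≤ 1 / (L * (1 + 1 / (1 - θ)))) (hN : 0 ≤ N) (hD : 0 ≤ D)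
    (hQ : Q ≤ N + 2 * L * D) :
    η / 2 * (1 + L * η) * Q ≤ η * N + (1 - θ) * D := by
  obtain ⟨hθ0, hθ1⟩ := hθ
  have hs : 0 < 1 - θ := by linarith
  have hr : L * η * (1 + 1 / (1 - θ)) ≤ 1 := by
    rw [le_div_iff₀ (by positivity)] at hηle
    linarith
  have hr' : L * η * (2 - θ) ≤ 1 - θ := by
    have := mul_le_mul_of_nonneg_right hr hs.le
    field_simp at this
    linarith
  have hLη : 0 < L * η := mul_pos hL hη
  have hone : L * η ≤ 1 := by nlinarith
  have hcoef : L * η * (1 + L * η) ≤ 1 - θ := by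
    have hle : L * η ≤ 1 - θ := by nlinarith
    nlinarith
  calc η / 2 * (1 + L * η) * Q ≤ η / 2 * (1 + L * η) * (N + 2 * L * D) := by gcongr
    _ = η * N * ((1 + L * η) / 2) + L * η * (1 + L * η) * D := by ring
    _ ≤ η * N * 1 + (1 - θ) * D := by
        gcongr
        linarith
    _ = η * N + (1 - θ) * D := by ring

/-- Lemma 7 of the paper (one iteration of ANITA in the general convex case,
`μ = 0`, `α = θ`). -/
theorem anita_general_convex_one_step {d n : ℕ} (hn : 1 ≤ n)
    (f : Fin n → EuclideanSpace ℝ (Fin d) → ℝ) (L : ℝ) (hL : 0 < L)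
    (hdiff : ∀ i, Differentiable ℝ (f i))
    (hconv : ∀ i, ConvexOn ℝ Set.univ (f i))
    (hlip : ∀ i x y, ‖gradient (f i) x - gradient (f i) y‖ ≤ L * ‖x - y‖)
    (F : EuclideanSpace ℝ (Fin d) → ℝ)
    (hF : F = fun x => (1 / (n : ℝ)) * ∑ i, f i x)
    (xstar : EuclideanSpace ℝ (Fin d)) (hmin : ∀ y, F xstar ≤ F y)
    (x w : EuclideanSpace ℝ (Fin d)) (θ p η : ℝ)
    (hθ : θ ∈ Set.Ioo (0 : ℝ) 1) (hp : p ∈ Set.Ioc (0 : ℝ) 1) (hη : 0 < η)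
    (hηle : η ≤ 1 / (L * (1 + 1 / (1 - θ))))
    (u : EuclideanSpace ℝ (Fin d)) (hu : u = θ • x + (1 - θ) • w)
    (g xp b : Fin n → EuclideanSpace ℝ (Fin d))
    (hg : ∀ i, g i = gradient (f i) u - gradient (f i) w + gradient F w)
    (hxp : ∀ i, xp i = x - (η / θ) • g i)
    (hb : ∀ i, b i = θ • xp i + (1 - θ) • w) :
    (η / (p * θ ^ 2)) *
        ((1 / (n : ℝ)) * ∑ i, (p * F (b i) + (1 - p) * F w) - F xstar) ≤
      ((1 - p * θ) * η / (p * θ ^ 2)) * (F w - F xstar)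
        + (1 / 2) * (‖x - xstar‖ ^ 2 - (1 / (n : ℝ)) * ∑ i, ‖xp i - xstar‖ ^ 2) := by
  have hgrad (y) : HasGradientAt F ((1 / (n : ℝ)) • ∑ i, gradient (f i) y) y := by
    rw [hF]; exact hasGradientAt_average hdiff y
  have hgradF (y) : gradient F y = (1 / (n : ℝ)) • ∑ i, gradient (f i) y := (hgrad y).gradient
  have hFval (y) : F y = (1 / (n : ℝ)) * ∑ i, f i y := by rw [hF]
  set G := gradient F u with hG
  set H := gradient F w with hH
  have hlow (y) : F u + ⟪G, y - u⟫ ≤ F y := by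
    have h := average_mono fun i =>
      (hconv i).add_inner_gradient_le (hdiff i u).hasGradientAt y
    rw [Finset.sum_add_distrib, mul_add, ← sum_inner, ← real_inner_smul_left, ← hgradF] at h
    rwa [← hFval, ← hFval] at h
  have hFdiff : Differentiable ℝ F := fun y => (hgrad y).differentiableAt
  have hFlip (y z) : ‖gradient F y - gradient F z‖ ≤ L * ‖y - z‖ := by
    rw [hgradF, hgradF, ← smul_sub, ← Finset.sum_sub_distrib, norm_smul,
      Real.norm_of_nonneg (by positivity)]
    calc (1 / (n : ℝ)) * ‖∑ i, (gradient (f i) y - gradient (f i) z)‖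
        ≤ (1 / (n : ℝ)) * ∑ i, ‖gradient (f i) y - gradient (f i) z‖ := by
          gcongr; exact norm_sum_le _ _
      _ ≤ (1 / (n : ℝ)) * ∑ _i : Fin n, L * ‖y - z‖ := average_mono fun i => hlip i y z
      _ = L * ‖y - z‖ := average_const hn _
  have hinner_a (v) : (1 / (n : ℝ)) * ∑ i, ⟪gradient (f i) u - gradient (f i) w, v⟫
      = ⟪G - H, v⟫ := by
    rw [← sum_inner, ← real_inner_smul_left, Finset.sum_sub_distrib, smul_sub, ← hgradF, ← hgradF]
  have hinner_g (v) : (1 / (n : ℝ)) * ∑ i, ⟪g i, v⟫ = ⟪G, v⟫ := by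
    simp only [hg, inner_add_left, Finset.sum_add_distrib, mul_add]
    rw [hinner_a, average_const hn, ← inner_add_left, sub_add_cancel]
  set Q := (1 / (n : ℝ)) * ∑ i, ‖g i‖ ^ 2 with hQdef
  set D := F w - F u - ⟪G, w - u⟫ with hD
  have hvar : (1 / (n : ℝ)) * ∑ i, ‖gradient (f i) u - gradient (f i) w‖ ^ 2 ≤ 2 * L * D := by
    have h := average_mono fun i =>
      (hconv i).norm_gradient_sub_sq_le hL (hdiff i) (hlip i) u w
    rw [← Finset.mul_sum, Finset.sum_sub_distrib, Finset.sum_sub_distrib, ← sum_inner] at h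
    have hGw : ⟪G, w - u⟫ = (1 / (n : ℝ)) * ⟪∑ i, gradient (f i) u, w - u⟫ := by
      rw [hG, hgradF, real_inner_smul_left]
    rw [hD, hGw, hF]
    linarith
  have hQ : Q ≤ ‖G‖ ^ 2 + 2 * L * D := by
    have hsum : Q = (1 / (n : ℝ)) * ∑ i, ‖gradient (f i) u - gradient (f i) w‖ ^ 2
        + 2 * ⟪G - H, H⟫ + ‖H‖ ^ 2 := by
      simp only [hQdef, hg, norm_add_sq_real, Finset.sum_add_distrib, mul_add]
      rw [average_const hn, ← hinner_a, ← Finset.mul_sum]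
      ring
    have hsq : ‖G‖ ^ 2 = ‖G - H‖ ^ 2 + 2 * ⟪G - H, H⟫ + ‖H‖ ^ 2 := by
      rw [← norm_add_sq_real, sub_add_cancel]
    nlinarith [sq_nonneg ‖G - H‖]
  obtain ⟨hθ0, hθ1⟩ := id hθ
  obtain ⟨hp0, hp1⟩ := hp
  have hbu (i) : b i - u = -(η • g i) := by
    rw [hb, hxp, hu, smul_sub, smul_smul, mul_div_cancel₀ _ hθ0.ne']
    abel
  have hdescent : (1 / (n : ℝ)) * ∑ i, F (b i) ≤ F u - η * ‖G‖ ^ 2 + L / 2 * η ^ 2 * Q := by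
    have h := average_mono fun i => le_add_inner_gradient_add_sq hFdiff hFlip u (b i)
    simp only [hbu, norm_neg, inner_neg_right, norm_smul, Real.norm_of_nonneg hη.le, mul_pow,
      real_inner_smul_right, Finset.sum_add_distrib, mul_add, average_const hn,
      Finset.sum_neg_distrib, ← Finset.mul_sum] at h
    have hGg := hinner_g G
    simp only [real_inner_comm G, real_inner_self_eq_norm_sq] at hGg
    rw [← hG] at h
    have h1 : (1 / (n : ℝ)) * -(η * ∑ i, ⟪G, g i⟫) = - (η * ‖G‖ ^ 2) := by
      rw [← hGg]; ring
    have h2 : (1 / (n : ℝ)) * (L / 2 * (η ^ 2 * ∑ i, ‖g i‖ ^ 2)) = L / 2 * η ^ 2 * Q := by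
      rw [hQdef]; ring
    linarith
  have hdist : (1 / (n : ℝ)) * ∑ i, ‖xp i - xstar‖ ^ 2
      = ‖x - xstar‖ ^ 2 - 2 * (η / θ) * ⟪G, x - xstar⟫ + (η / θ) ^ 2 * Q := by
    have hterm (i) : ‖xp i - xstar‖ ^ 2
        = ‖x - xstar‖ ^ 2 - 2 * (η / θ) * ⟪g i, x - xstar⟫ + (η / θ) ^ 2 * ‖g i‖ ^ 2 := by
      rw [hxp, sub_right_comm, norm_sub_sq_real, real_inner_smul_right, norm_smul, mul_pow,
        Real.norm_of_nonneg (by positivity), real_inner_comm]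
      ring
    simp only [hterm, Finset.sum_add_distrib, Finset.sum_sub_distrib, mul_add, mul_sub,
      ← Finset.mul_sum, average_const hn]
    rw [← hinner_g, hQdef]
    ring
  have hstep := stepSize_inequality hL hθ hη hηle (sq_nonneg ‖G‖)
    (by linarith [hlow w] : 0 ≤ D) hQ
  have hcoupling : θ * ⟪G, x - xstar⟫ = -(θ * ⟪G, xstar - u⟫) - (1 - θ) * ⟪G, w - u⟫ := by
    rw [← real_inner_smul_right, ← real_inner_smul_right, ← real_inner_smul_right,
      ← inner_neg_right, ← inner_sub_right]
    congr 1
    rw [hu]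
    module
  have hmain : (1 / (n : ℝ)) * ∑ i, F (b i) ≤ (1 - θ) * F w + θ * F xstar
      + θ * ⟪G, x - xstar⟫ - η / 2 * Q := by
    have hstar := mul_le_mul_of_nonneg_left (hlow xstar) hθ0.le
    rw [hcoupling]
    rw [hD] at hstep
    linarith
  rw [Finset.sum_add_distrib, mul_add, average_const hn, ← Finset.mul_sum, mul_left_comm, hdist]
  set B := (1 / (n : ℝ)) * ∑ i, F (b i)
  have hgap : 0 ≤ η / θ ^ 2 * ((1 - θ) * F w + θ * F xstar
      + θ * ⟪G, x - xstar⟫ - η / 2 * Q - B) :=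
    mul_nonneg (by positivity) (sub_nonneg.2 hmain)
  rw [← sub_nonneg]
  refine hgap.trans_eq ?_
  field_simp
  ring
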